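/- arXiv:1408.4666 — 7 statements merged into one kernel-verified Lean document; each statement's English description precedes it below -/
import Mathlib

section
/- (First part of Lemma 1.) Let K > 0, τ ≥ 0, N ≥ 1 and n ∈ {0,…,N−1}. Then every complex solution μ of the scalar characteristic equation 0 = μ + K − K·e^{−μτ}·e^{2πin/N} satisfies Re(μ) ≤ 0. Consequently, for a synchronous solution x_j(t) = Ω·t of the delayed ring of phase oscillators with κ·cos(Ωτ) > 0, no characteristic exponent has positive real part. -/
/-- If `K > 0`, `τ ≥ 0` and `‖w‖ ≤ 1`, every solution `μ` of `μ + K - K * exp (-μ * τ) * w = 0`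
has nonpositive real part. -/
theorem re_nonpos_of_add_sub_mul_exp_eq_zero {K τ : ℝ} (hK : 0 < K) (hτ : 0 ≤ τ) {w μ : ℂ}
    (hw : ‖w‖ ≤ 1) (hμ : μ + (K : ℂ) - (K : ℂ) * Complex.exp (-μ * (τ : ℂ)) * w = 0) :
    μ.re ≤ 0 := by
  by_contra! hpos
  have hexp : ‖Complex.exp (-μ * (τ : ℂ))‖ ≤ 1 := by
    rw [Complex.norm_exp, Real.exp_le_one_iff, Complex.re_mul_ofReal, Complex.neg_re]
    nlinarith
  have hle : (μ + (K : ℂ)).re ≤ K := by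
    refine (Complex.re_le_norm _).trans ?_
    rw [sub_eq_zero.mp hμ, mul_assoc, norm_mul, norm_mul, Complex.norm_of_nonneg hK.le]
    exact mul_le_of_le_one_right hK.le (mul_le_one₀ hexp (norm_nonneg _) hw)
  rw [Complex.add_re, Complex.ofReal_re] at hle
  linarith


/-- first part of Lemma 1. For `K > 0`, `τ ≥ 0`, every complex
solution `μ` of the scalar characteristic equation
`0 = μ + K − K·e^{−μτ}·e^{2πin/N}` satisfies `Re μ ≤ 0`; hence for a synchronous
solution with `κ·cos(Ωτ) > 0` no characteristic exponent has positive real part. -/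
theorem characteristic_exponents_nonpositive_real_part
    (K τ : ℝ) (hK : 0 < K) (hτ : 0 ≤ τ) (N : ℕ) (hN : 1 ≤ N)
    (n : ℕ) (hn : n < N) (μ : ℂ)
    (hμ : μ + (K : ℂ) - (K : ℂ) * Complex.exp (-μ * (τ : ℂ)) *
        Complex.exp (2 * (Real.pi : ℂ) * Complex.I * (n : ℂ) / (N : ℂ)) = 0) :
    μ.re ≤ 0 := by
  refine re_nonpos_of_add_sub_mul_exp_eq_zero hK hτ (le_of_eq ?_) hμ
  have harg : 2 * (Real.pi : ℂ) * Complex.I * (n : ℂ) / (N : ℂ) =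
      ((2 * Real.pi * n / N : ℝ) : ℂ) * Complex.I := by
    push_cast
    ring
  rw [harg, Complex.norm_exp_ofReal_mul_I]
end

section
/- Let K > 0, τ > 0, N ≥ 1, and let n ∈ {1,…,N−1} be such that e^{2πin/N} ≠ 1. Then every complex solution μ of the scalar characteristic equation 0 = μ + K − K·e^{−μτ}·e^{2πin/N} satisfies Re(μ) < 0 (strictly). Together with the fact that for n = 0 the only root on the imaginary axis is the trivial root μ = 0, this shows that a synchronous solution with K = κ·cos(Ωτ) > 0 is linearly stable. -/
/-- A root `μ` of `μ + K = K e^{-μτ} ζ` with `‖ζ‖ ≤ 1` and `0 ≤ Re μ` vanishes: the right-hand side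
has norm at most `K`, whereas `K ≤ Re (μ + K)`. -/
theorem eq_zero_of_add_eq_mul_exp_mul {K τ : ℝ} (hK : 0 < K) (hτ : 0 ≤ τ) {ζ μ : ℂ}
    (hζ : ‖ζ‖ ≤ 1) (hre : 0 ≤ μ.re)
    (hμ : μ + (K : ℂ) = (K : ℂ) * Complex.exp (-μ * (τ : ℂ)) * ζ) : μ = 0 := by
  have hexp : ‖Complex.exp (-μ * (τ : ℂ))‖ ≤ 1 := by
    rw [Complex.norm_exp, Real.exp_le_one_iff, Complex.re_mul_ofReal, Complex.neg_re]
    nlinarith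
  have hnorm : ‖μ + (K : ℂ)‖ ≤ K := by
    rw [hμ, mul_assoc, norm_mul, norm_mul, Complex.norm_of_nonneg hK.le]
    exact mul_le_of_le_one_right hK.le (mul_le_one₀ hexp (norm_nonneg ζ) hζ)
  have hsq : (μ.re + K) ^ 2 + μ.im ^ 2 ≤ K ^ 2 := by
    have h := pow_le_pow_left₀ (norm_nonneg _) hnorm 2
    rw [Complex.sq_norm, Complex.normSq_apply] at h
    simp only [Complex.add_re, Complex.add_im, Complex.ofReal_re, Complex.ofReal_im,
      add_zero] at h
    linarith
  have hre0 : μ.re = 0 := by nlinarith [sq_nonneg μ.im]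
  have him0 : μ.im = 0 := by
    rw [hre0] at hsq
    nlinarith
  exact Complex.ext hre0 him0

/-- For `K > 0`, `τ > 0` and `n ∈ {1,…,N−1}` with
`e^{2πin/N} ≠ 1`, every complex solution `μ` of the scalar characteristic
equation `0 = μ + K − K·e^{−μτ}·e^{2πin/N}` satisfies `Re μ < 0` strictly. -/
theorem characteristic_exponents_negative_real_part
    (K τ : ℝ) (hK : 0 < K) (hτ : 0 < τ) (N : ℕ) (hN : 1 ≤ N)
    (n : ℕ) (hn1 : 1 ≤ n) (hn : n < N)
    (hroot : Complex.exp (2 * (Real.pi : ℂ) * Complex.I * (n : ℂ) / (N : ℂ)) ≠ 1)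
    (μ : ℂ)
    (hμ : μ + (K : ℂ) - (K : ℂ) * Complex.exp (-μ * (τ : ℂ)) *
        Complex.exp (2 * (Real.pi : ℂ) * Complex.I * (n : ℂ) / (N : ℂ)) = 0) :
    μ.re < 0 := by
  by_contra! hre
  have hζ : ‖Complex.exp (2 * (Real.pi : ℂ) * Complex.I * (n : ℂ) / (N : ℂ))‖ = 1 := by
    rw [show 2 * (Real.pi : ℂ) * Complex.I * (n : ℂ) / (N : ℂ)
      = ((2 * Real.pi * n / N : ℝ) : ℂ) * Complex.I by push_cast; ring]
    exact Complex.norm_exp_ofReal_mul_I _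
  have h0 : μ = 0 := eq_zero_of_add_eq_mul_exp_mul hK hτ.le hζ.le hre (sub_eq_zero.mp hμ)
  rw [h0, zero_add, neg_zero, zero_mul, Complex.exp_zero, mul_one, sub_eq_zero] at hμ
  exact hroot (mul_left_cancel₀ (Complex.ofReal_ne_zero.mpr hK.ne') (by rw [mul_one, ← hμ]))
end

section
/- (Second part of Lemma 1.) Let K < 0, τ ≥ 0, N ≥ 1 and n ∈ {0,…,N−1}. Then every complex solution μ of the scalar characteristic equation 0 = μ + K − K·e^{−μτ}·e^{2πin/N} satisfies Re(μ) ≤ −2K. In particular, for a synchronous solution x_j(t) = Ω·t with K = κ·cos(Ωτ) < 0, every characteristic exponent μ satisfies Re(μ) ≤ −2κ·cos(Ωτ). -/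
/-- second part of Lemma 1. For `K < 0`, `τ ≥ 0`, every complex
solution `μ` of the scalar characteristic equation
`0 = μ + K − K·e^{−μτ}·e^{2πin/N}` satisfies `Re μ ≤ −2K`; in particular, for a
synchronous solution with `K = κ·cos(Ωτ) < 0` every characteristic exponent `μ`
satisfies `Re μ ≤ −2κ·cos(Ωτ)`. -/
theorem characteristic_exponents_upper_bound
    (K τ : ℝ) (hK : K < 0) (hτ : 0 ≤ τ) (N : ℕ) (hN : 1 ≤ N)
    (n : ℕ) (hn : n < N) (μ : ℂ)
    (hμ : μ + (K : ℂ) - (K : ℂ) * Complex.exp (-μ * (τ : ℂ)) *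
        Complex.exp (2 * (Real.pi : ℂ) * Complex.I * (n : ℂ) / (N : ℂ)) = 0) :
    μ.re ≤ -2 * K := by
  by_contra! hre
  have hroot : ‖Complex.exp (2 * (Real.pi : ℂ) * Complex.I * (n : ℂ) / (N : ℂ))‖ = 1 := by
    have harg : 2 * (Real.pi : ℂ) * Complex.I * (n : ℂ) / (N : ℂ)
        = ((2 * Real.pi * n / N : ℝ) : ℂ) * Complex.I := by
      push_cast
      ring
    rw [harg, Complex.norm_exp_ofReal_mul_I]
  have hdecay : ‖Complex.exp (-μ * (τ : ℂ))‖ ≤ 1 := by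
    rw [Complex.norm_exp, Real.exp_le_one_iff, Complex.re_mul_ofReal, Complex.neg_re]
    exact mul_nonpos_of_nonpos_of_nonneg (by linarith) hτ
  have hnorm : ‖μ + (K : ℂ)‖ ≤ -K := by
    rw [sub_eq_zero.mp hμ, norm_mul, norm_mul, hroot, mul_one, Complex.norm_real,
      Real.norm_of_nonpos hK.le]
    exact mul_le_of_le_one_right (by linarith) hdecay
  have hle := (Complex.re_le_norm (μ + (K : ℂ))).trans hnorm
  rw [Complex.add_re, Complex.ofReal_re] at hle
  linarith
end

section
/- (No Hopf bifurcations.) Let K ∈ ℝ with K ≠ 0, τ ≥ 0, N ≥ 1 and n ∈ {0,…,N−1}. If y ∈ ℝ is such that μ = iy is a purely imaginary solution of the scalar characteristic equation 0 = μ + K − K·e^{−μτ}·e^{2πin/N}, then y = 0. Hence characteristic exponents of a synchronous solution of the delayed ring can only cross the imaginary axis through the origin, and Hopf bifurcations with nonzero frequency cannot occur. -/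
/-- A circle of radius `|K|` about the origin meets the vertical line through `K` only in `K`. -/
theorem eq_zero_of_norm_ofReal_add_mul_I_eq {K y : ℝ}
    (h : ‖(K : ℂ) + (y : ℂ) * Complex.I‖ = ‖(K : ℂ)‖) : y = 0 := by
  have hsq : Complex.normSq ((K : ℂ) + (y : ℂ) * Complex.I) = Complex.normSq (K : ℂ) := by
    rw [Complex.normSq_eq_norm_sq, Complex.normSq_eq_norm_sq, h]
  rw [Complex.normSq_add_mul_I, Complex.normSq_ofReal] at hsq
  exact pow_eq_zero_iff two_ne_zero |>.mp (by linarith)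

/-- no Hopf bifurcations. For `K ≠ 0`, `τ ≥ 0`, if `μ = iy`
(`y ∈ ℝ`) is a purely imaginary solution of the scalar characteristic equation
`0 = μ + K − K·e^{−μτ}·e^{2πin/N}`, then `y = 0`: characteristic exponents can
only cross the imaginary axis through the origin. -/
theorem no_hopf_bifurcations
    (K τ : ℝ) (hK : K ≠ 0) (hτ : 0 ≤ τ) (N : ℕ) (hN : 1 ≤ N)
    (n : ℕ) (hn : n < N) (y : ℝ)
    (hy : Complex.I * (y : ℂ) + (K : ℂ) - (K : ℂ) *
        Complex.exp (-(Complex.I * (y : ℂ)) * (τ : ℂ)) *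
        Complex.exp (2 * (Real.pi : ℂ) * Complex.I * (n : ℂ) / (N : ℂ)) = 0) :
    y = 0 := by
  apply eq_zero_of_norm_ofReal_add_mul_I_eq (K := K)
  have hexp : (K : ℂ) + (y : ℂ) * Complex.I =
      K * Complex.exp (((-(y * τ) : ℝ) : ℂ) * Complex.I) *
        Complex.exp (((2 * Real.pi * n / N : ℝ) : ℂ) * Complex.I) := by
    rw [← sub_eq_zero, ← hy]
    push_cast
    ring_nf
  rw [hexp, norm_mul, norm_mul, Complex.norm_exp_ofReal_mul_I, Complex.norm_exp_ofReal_mul_I,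
    mul_one, mul_one]
end

section
/- (Lemma 2, stable solutions.) Let ω ∈ ℝ, κ > 0, τ > 0 with 2κτ > π, and define f(Ω) = Ω − ω + κ·sin(Ωτ). Then the number of real solutions Ω of f(Ω) = 0 satisfying cos(Ωτ) ≥ 0 is at least κτ/π − 1/2. (These are the synchronous solutions x_j(t) = Ω·t of the delayed ring whose stability coefficient K = κ·cos(Ωτ) is nonnegative; those with cos(Ωτ) > 0 are the linearly stable ones.) -/
open Real

/-- The map `x ↦ x - a + b * sin x` has a zero in `[2πk - π/2, 2πk + π/2]` as soon as its values
at the endpoints have opposite signs. -/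
lemma exists_zero_sub_add_mul_sin (a b : ℝ) (k : ℤ)
    (hl : 2 * π * k ≤ a + b + π / 2) (hu : a - b - π / 2 ≤ 2 * π * k) :
    ∃ x ∈ Set.Icc (2 * π * k - π / 2) (2 * π * k + π / 2), x - a + b * sin x = 0 := by
  have hcont : ContinuousOn (fun x : ℝ => x - a + b * sin x)
      (Set.Icc (2 * π * k - π / 2) (2 * π * k + π / 2)) := by fun_prop
  have hle : 2 * π * k - π / 2 ≤ 2 * π * k + π / 2 := by linarith [pi_pos]
  have hsl : sin (2 * π * k - π / 2) = -1 := by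
    rw [sin_sub_pi_div_two, show 2 * π * k = k * (2 * π) by ring, cos_int_mul_two_pi]
  have hsu : sin (2 * π * k + π / 2) = 1 := by
    rw [sin_add_pi_div_two, show 2 * π * k = k * (2 * π) by ring, cos_int_mul_two_pi]
  refine intermediate_value_Icc hle hcont ⟨?_, ?_⟩
  · simp only [hsl]; linarith
  · simp only [hsu]; linarith

lemma cos_nonneg_of_mem_Icc_two_pi_mul_int {x : ℝ} {k : ℤ}
    (hx : x ∈ Set.Icc (2 * π * k - π / 2) (2 * π * k + π / 2)) : 0 ≤ cos x := by
  rw [← cos_sub_int_mul_two_pi x k]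
  exact cos_nonneg_of_mem_Icc ⟨by linarith [hx.1], by linarith [hx.2]⟩

lemma int_le_of_mem_Icc_two_pi_mul_int {x : ℝ} {k l : ℤ}
    (hk : x ∈ Set.Icc (2 * π * k - π / 2) (2 * π * k + π / 2))
    (hl : x ∈ Set.Icc (2 * π * l - π / 2) (2 * π * l + π / 2)) : k ≤ l := by
  by_contra! hlt
  have hlt' : (l : ℝ) + 1 ≤ k := by exact_mod_cast hlt
  nlinarith [hk.1, hl.2, pi_pos]

lemma sub_sub_one_le_card_Icc_ceil_floor (u v : ℝ) :
    v - u - 1 ≤ ((Finset.Icc ⌈u⌉ ⌊v⌋).card : ℝ) := by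
  have hcard : ⌊v⌋ + 1 - ⌈u⌉ ≤ ((Finset.Icc ⌈u⌉ ⌊v⌋).card : ℤ) := by
    rw [Int.card_Icc]
    exact Int.self_le_toNat _
  have hcard' : (⌊v⌋ : ℝ) + 1 - ⌈u⌉ ≤ ((Finset.Icc ⌈u⌉ ⌊v⌋).card : ℝ) := by exact_mod_cast hcard
  linarith [Int.ceil_lt_add_one u, Int.lt_floor_add_one v]

/-- Lemma 2, stable solutions. For `κ > 0`, `τ > 0` with
`2κτ > π`, the number of real zeros `Ω` of `f(Ω) = Ω − ω + κ·sin(Ωτ)` with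
`cos(Ωτ) ≥ 0` is at least `κτ/π − 1/2`. -/
theorem number_of_stable_synchronous_solutions
    (ω κ τ : ℝ) (hκ : 0 < κ) (hτ : 0 < τ) (h : π < 2 * κ * τ) :
    ∃ s : Finset ℝ,
      (∀ Ω ∈ s, Ω - ω + κ * Real.sin (Ω * τ) = 0 ∧ 0 ≤ Real.cos (Ω * τ)) ∧
      κ * τ / π - 1 / 2 ≤ (s.card : ℝ) := by
  set u : ℝ := (ω * τ - κ * τ - π / 2) / (2 * π) with hu
  set v : ℝ := (ω * τ + κ * τ + π / 2) / (2 * π) with hv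
  have h2π : 0 < 2 * π := two_pi_pos
  have hzero : ∀ k ∈ Finset.Icc ⌈u⌉ ⌊v⌋,
      ∃ x ∈ Set.Icc (2 * π * k - π / 2) (2 * π * k + π / 2),
        x - ω * τ + κ * τ * sin x = 0 := by
    intro k hk
    rw [Finset.mem_Icc, Int.ceil_le, Int.le_floor, hu, hv, div_le_iff₀' h2π,
      le_div_iff₀' h2π] at hk
    exact exists_zero_sub_add_mul_sin _ _ _ hk.2 hk.1
  choose! x hmem hx using hzero
  refine ⟨(Finset.Icc ⌈u⌉ ⌊v⌋).image fun k => x k / τ, ?_, ?_⟩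
  · simp only [Finset.forall_mem_image]
    intro k hk
    rw [div_mul_cancel₀ _ hτ.ne']
    refine ⟨?_, cos_nonneg_of_mem_Icc_two_pi_mul_int (hmem k hk)⟩
    have hxk := hx k hk
    field_simp
    linarith
  · rw [Finset.card_image_of_injOn]
    · refine le_trans (le_of_eq ?_) (sub_sub_one_le_card_Icc_ceil_floor u v)
      rw [hu, hv]
      field_simp
      ring
    · intro k hk l hl hkl
      have hxkl : x k = x l := (div_left_inj' hτ.ne').mp hkl
      have hl' := hmem l hl
      rw [← hxkl] at hl'
      exact le_antisymm (int_le_of_mem_Icc_two_pi_mul_int (hmem k hk) hl')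
        (int_le_of_mem_Icc_two_pi_mul_int hl' (hmem k hk))
end

section
/- Let ω ∈ ℝ, κ > 0, τ > 0, and define f(Ω) = Ω − ω + κ·sin(Ωτ). For each l ∈ ℤ such that the closed interval J̄_l = [π/(2τ) + 2πl/τ, 3π/(2τ) + 2πl/τ] is contained in [ω − κ, ω + κ], the function f has at least one zero in J̄_l; every zero Ω in the open interval J_l satisfies cos(Ωτ) < 0 and hence corresponds to a linearly unstable synchronous solution. -/
open Real

/-- If the closed interval
`J̄_l = [π/(2τ) + 2πl/τ, 3π/(2τ) + 2πl/τ]` is contained in `[ω − κ, ω + κ]`,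
then `f(Ω) = Ω − ω + κ·sin(Ωτ)` has at least one zero in `J̄_l`, and every zero
in the open interval `J_l` satisfies `cos(Ωτ) < 0` (hence corresponds to a
linearly unstable synchronous solution). -/
theorem zero_in_instability_interval
    (ω κ τ : ℝ) (hκ : 0 < κ) (hτ : 0 < τ) (l : ℤ)
    (hsub : Set.Icc (π / (2 * τ) + 2 * π * l / τ) (3 * π / (2 * τ) + 2 * π * l / τ)
      ⊆ Set.Icc (ω - κ) (ω + κ)) :
    (∃ Ω ∈ Set.Icc (π / (2 * τ) + 2 * π * l / τ) (3 * π / (2 * τ) + 2 * π * l / τ),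
        Ω - ω + κ * Real.sin (Ω * τ) = 0) ∧
      ∀ Ω ∈ Set.Ioo (π / (2 * τ) + 2 * π * l / τ) (3 * π / (2 * τ) + 2 * π * l / τ),
        Ω - ω + κ * Real.sin (Ω * τ) = 0 → Real.cos (Ω * τ) < 0 := by
  set a := π / (2 * τ) + 2 * π * l / τ with ha
  set b := 3 * π / (2 * τ) + 2 * π * l / τ with hb
  have haτ : a * τ = π / 2 + l * (2 * π) := by rw [ha]; field_simp
  have hbτ : b * τ = 3 * π / 2 + l * (2 * π) := by rw [hb]; field_simp
  have hab : a ≤ b := by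
    refine le_of_mul_le_mul_right ?_ hτ
    linarith [pi_pos]
  have hsin_a : sin (a * τ) = 1 := by
    rw [haτ, sin_add_int_mul_two_pi, sin_pi_div_two]
  have hsin_b : sin (b * τ) = -1 := by
    rw [hbτ, sin_add_int_mul_two_pi, show 3 * π / 2 = π / 2 + π by ring, sin_add_pi,
      sin_pi_div_two]
  refine ⟨?_, fun Ω hΩ _ => ?_⟩
  · have hcont : ContinuousOn (fun Ω => Ω - ω + κ * sin (Ω * τ)) (Set.Icc a b) := by
      fun_prop
    refine intermediate_value_Icc' hab hcont ⟨?_, ?_⟩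
    · have := (hsub (Set.right_mem_Icc.2 hab)).2
      simp only [hsin_b]
      linarith
    · have := (hsub (Set.left_mem_Icc.2 hab)).1
      simp only [hsin_a]
      linarith
  · have h₁ := mul_lt_mul_of_pos_right hΩ.1 hτ
    have h₂ := mul_lt_mul_of_pos_right hΩ.2 hτ
    rw [← cos_sub_int_mul_two_pi _ l]
    exact cos_neg_of_pi_div_two_lt_of_lt (by linarith) (by linarith)
end

section
/- (Encoded pattern is an exact solution.) Let N ≥ 1, ω, κ ∈ ℝ, τ ≥ 0, and let Ω ∈ ℝ satisfy the frequency equation Ω = ω − κ·sin(Ωτ). Let p_1,…,p_N ∈ ℝ (indices mod N) and set τ_j := τ − (p_{j+1} − p_j). Then the functions y_j(t) := Ω·(t − p_j) solve the heterogeneous-delay ring ẏ_j(t) = ω + κ·sin(y_{j+1}(t−τ_j) − y_j(t)) for all t ∈ ℝ; i.e., the ring with delays τ_j exhibits the prescribed firing sequence p_1,…,p_N (oscillator j crosses a fixed phase at times p_j + 2πk/Ω) as an exact solution. -/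
/-- encoded pattern is an exact solution. If `Ω` satisfies
the frequency equation `Ω = ω − κ·sin(Ωτ)` and the delays are set to
`τ_j = τ − (p_{j+1} − p_j)`, then the time-shifted synchronous functions
`y_j(t) = Ω·(t − p_j)` solve the heterogeneous-delay ring
`ẏ_j(t) = ω + κ·sin(y_{j+1}(t−τ_j) − y_j(t))`. -/
theorem encoded_pattern_is_solution
    (N : ℕ) [NeZero N] (hN : 1 ≤ N) (ω κ τ : ℝ) (hτ : 0 ≤ τ)
    (Ω : ℝ) (hΩ : Ω = ω - κ * Real.sin (Ω * τ))
    (p : Fin N → ℝ) :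
    ∀ (j : Fin N) (t : ℝ),
      HasDerivAt (fun s => Ω * (s - p j))
        (ω + κ * Real.sin
          (Ω * ((t - (τ - (p (j + 1) - p j))) - p (j + 1)) - Ω * (t - p j))) t := by
  intro j t
  have harg : Ω * ((t - (τ - (p (j + 1) - p j))) - p (j + 1)) - Ω * (t - p j) = -(Ω * τ) := by
    ring
  rw [harg, Real.sin_neg, mul_neg, ← sub_eq_add_neg, ← hΩ]
  simpa using ((hasDerivAt_id t).sub_const (p j)).const_mul Ω
end
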